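/- arXiv:2301.02204 — 2 statements merged into one kernel-verified Lean document; each statement's English description precedes it below -/
import Mathlib

section
/- Let S be the stabilizer of the pair (0⃗, 1⃗) in ASL_H(2,n) and let m = α/ω. The number N of orbits of S acting on V \ {0⃗, 1⃗} satisfies m·(N + 3) = 2·∑_{β=1}^{m} q^{gcd(m,β)} (equivalently, N = −3 + (2/m)·∑_{β=1}^{m} q^{gcd(m,β)}). -/
open Matrix

/-- `InH K φ` means `φ` belongs to `H = Gal(F/K)`, the group of field
automorphisms of `F` fixing the subfield `K` pointwise. -/
def InH {F : Type*} [Field F] (K : Subfield F) (φ : F ≃+* F) : Prop :=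
  ∀ x ∈ K, φ x = x

/-- Membership in `ASL_H(2,n)`: maps `v ↦ A·φ(v) + b` with `A ∈ SL(2,F)`,
`b ∈ V`, `φ ∈ H`, acting on `V = F²`. -/
def IsASLH {F : Type*} [Field F] (K : Subfield F)
    (g : (Fin 2 → F) → (Fin 2 → F)) : Prop :=
  ∃ (A : Matrix (Fin 2) (Fin 2) F) (b : Fin 2 → F) (φ : F ≃+* F),
    A.det = 1 ∧ InH K φ ∧ ∀ v, g v = A.mulVec (fun i => φ (v i)) + b

open MulAction Module

/-- The stabilizer of `(0⃗, 1⃗)` consists of the maps `v ↦ φ(v) + t(φ(v₀) - φ(v₁))·1⃗`. -/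
theorem exists_isASLH_fixing_iff {F : Type*} [Field F] (K : Subfield F) (v w : Fin 2 → F) :
    (∃ g, IsASLH K g ∧ g ![0,0] = ![0,0] ∧ g ![1,1] = ![1,1] ∧ w = g v) ↔
      ∃ (φ : F ≃ₐ[K] F) (t : F), w = fun i => φ (v i) + t * (φ (v 0) - φ (v 1)) := by
  constructor
  · rintro ⟨g, ⟨A, b, φ, hA, hφ, hg⟩, h0, h1, rfl⟩
    rw [hg] at h0 h1
    have hb0 := congrFun h0 0
    have hb1 := congrFun h0 1
    have ha0 := congrFun h1 0
    have ha1 := congrFun h1 1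
    simp at hb0 hb1 ha0 ha1
    rw [Matrix.det_fin_two] at hA
    rw [hb0] at ha0
    rw [hb1] at ha1
    refine ⟨AlgEquiv.ofRingEquiv (f := φ) fun x => hφ x x.2, A 1 0, ?_⟩
    change g v = fun i => φ (v i) + A 1 0 * (φ (v 0) - φ (v 1))
    funext i
    rw [hg]
    have h10 : A 0 0 = 1 + A 1 0 := by
      linear_combination hA + A 1 0 * ha0 - A 0 0 * ha1
    fin_cases i
    · simp [hb0]
      linear_combination (φ (v 0) - φ (v 1)) * h10 + φ (v 1) * ha0
    · simp [hb1]
      linear_combination φ (v 1) * ha1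
  · rintro ⟨φ, t, rfl⟩
    refine ⟨_, ⟨!![1 + t, -t; t, 1 - t], 0, φ.toRingEquiv, ?_, fun x hx => φ.commutes ⟨x, hx⟩,
      fun v => rfl⟩, ?_, ?_, ?_⟩
    · rw [Matrix.det_fin_two_of]; ring
    · funext i
      fin_cases i <;> simp [dotProduct, Fin.sum_univ_two]
    · funext i
      fin_cases i <;> simp [dotProduct, Fin.sum_univ_two]
    · funext i
      fin_cases i <;> simp [dotProduct, Fin.sum_univ_two] <;> ring

/-- A vector off the diagonal is moved to all vectors with a conjugate coordinate difference. -/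
theorem setOf_isASLH_fixing_of_ne {F : Type*} [Field F] (K : Subfield F) {v : Fin 2 → F}
    (hv : v 0 ≠ v 1) :
    {w : Fin 2 → F | ∃ g, IsASLH K g ∧ g ![0,0] = ![0,0] ∧ g ![1,1] = ![1,1] ∧ w = g v} =
      (fun w : Fin 2 → F => w 0 - w 1) ⁻¹' orbit (F ≃ₐ[K] F) (v 0 - v 1) := by
  ext w
  rw [Set.mem_ofPred_eq, exists_isASLH_fixing_iff, Set.mem_preimage, mem_orbit_iff]
  constructor
  · rintro ⟨φ, t, rfl⟩
    exact ⟨φ, by simp [AlgEquiv.smul_def]⟩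
  · rintro ⟨φ, h⟩
    rw [AlgEquiv.smul_def, map_sub] at h
    have hne : φ (v 0) - φ (v 1) ≠ 0 := sub_ne_zero.2 (φ.injective.ne hv)
    refine ⟨φ, (w 0 - φ (v 0)) / (φ (v 0) - φ (v 1)), ?_⟩
    funext i
    rw [div_mul_cancel₀ _ hne]
    fin_cases i
    · simp
    · simp only [Fin.mk_one]
      linear_combination h

/-- A vector on the diagonal is moved to its conjugates. -/
theorem setOf_isASLH_fixing_of_eq {F : Type*} [Field F] (K : Subfield F) {v : Fin 2 → F}
    (hv : v 0 = v 1) :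
    {w : Fin 2 → F | ∃ g, IsASLH K g ∧ g ![0,0] = ![0,0] ∧ g ![1,1] = ![1,1] ∧ w = g v} =
      (fun (x : F) (_ : Fin 2) => x) '' orbit (F ≃ₐ[K] F) (v 0) := by
  ext w
  rw [Set.mem_ofPred_eq, exists_isASLH_fixing_iff]
  constructor
  · rintro ⟨φ, t, rfl⟩
    refine ⟨φ (v 0), ⟨φ, rfl⟩, ?_⟩
    funext i
    fin_cases i <;> simp [hv]
  · rintro ⟨_, ⟨φ, rfl⟩, rfl⟩
    refine ⟨φ, 0, ?_⟩
    funext i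
    fin_cases i <;> simp [hv, AlgEquiv.smul_def]

theorem orbit_algEquiv_algebraMap {R A : Type*} [CommSemiring R] [Semiring A] [Algebra R A]
    (r : R) : orbit (A ≃ₐ[R] A) (algebraMap R A r) = {algebraMap R A r} := by
  ext y
  simp [mem_orbit_iff, eq_comm]

/-- The orbits of the stabilizer of `(0⃗, 1⃗)` off the two fixed points, sorted into those off
the diagonal and those on it. -/
theorem range_setOf_isASLH_fixing {F : Type*} [Field F] (K : Subfield F) :
    (Set.range fun v : {v : Fin 2 → F // v ≠ ![0,0] ∧ v ≠ ![1,1]} =>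
      {w : Fin 2 → F | ∃ g, IsASLH K g ∧ g ![0,0] = ![0,0] ∧ g ![1,1] = ![1,1] ∧ w = g v.1}) =
      Set.preimage (fun w : Fin 2 → F => w 0 - w 1) ''
          (Set.range (orbit (F ≃ₐ[K] F) : F → Set F) \ {{0}}) ∪
        Set.image (fun (x : F) (_ : Fin 2) => x) ''
          (Set.range (orbit (F ≃ₐ[K] F) : F → Set F) \ {{0}, {1}}) := by
  have key : ∀ x y : F, orbit (F ≃ₐ[K] F) x = {y} → x = y := fun x y h => by
    have := mem_orbit_self (M := F ≃ₐ[K] F) x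
    rwa [h] at this
  have h0 : orbit (F ≃ₐ[K] F) (0 : F) = {0} := by
    simpa using orbit_algEquiv_algebraMap (A := F) (0 : K)
  have h1 : orbit (F ≃ₐ[K] F) (1 : F) = {1} := by
    simpa using orbit_algEquiv_algebraMap (A := F) (1 : K)
  ext S
  constructor
  · rintro ⟨⟨v, hv0, hv1⟩, rfl⟩
    by_cases hv : v 0 = v 1
    · refine Or.inr ⟨_, ⟨⟨v 0, rfl⟩, ?_⟩, (setOf_isASLH_fixing_of_eq K hv).symm⟩
      rintro (h | h)
      · refine hv0 (funext fun i => ?_)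
        have := key _ _ h
        fin_cases i <;> simp [← hv, this]
      · refine hv1 (funext fun i => ?_)
        have := key _ _ h
        fin_cases i <;> simp [← hv, this]
    · exact Or.inl ⟨_, ⟨⟨v 0 - v 1, rfl⟩, fun h => hv (sub_eq_zero.1 (key _ _ h))⟩,
        (setOf_isASLH_fixing_of_ne K hv).symm⟩
  · rintro (⟨_, ⟨⟨x, rfl⟩, hx⟩, rfl⟩ | ⟨_, ⟨⟨x, rfl⟩, hx⟩, rfl⟩)
    · have hx0 : x ≠ 0 := by
        rintro rfl
        exact hx h0
      refine ⟨⟨![x, 0], fun h => hx0 (congrFun h 0), fun h => ?_⟩, ?_⟩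
      · exact zero_ne_one (congrFun h 1)
      · refine (setOf_isASLH_fixing_of_ne K (v := ![x, 0]) hx0).trans ?_
        simp
    · refine ⟨⟨fun _ => x, fun h => hx (Or.inl ?_), fun h => hx (Or.inr ?_)⟩,
        setOf_isASLH_fixing_of_eq K rfl⟩
      · obtain rfl : x = 0 := congrFun h 0
        exact h0
      · obtain rfl : x = 1 := congrFun h 0
        exact h1

/-- The stabilizer of `(0⃗, 1⃗)` has three orbits fewer than twice the number of orbits of the
Galois group on the field. -/
theorem ncard_range_setOf_isASLH_fixing {F : Type*} [Field F] [Finite F] (K : Subfield F) :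
    (Set.range fun v : {v : Fin 2 → F // v ≠ ![0,0] ∧ v ≠ ![1,1]} =>
      {w : Fin 2 → F | ∃ g, IsASLH K g ∧ g ![0,0] = ![0,0] ∧ g ![1,1] = ![1,1] ∧
        w = g v.1}).ncard + 3 =
      2 * (Set.range (orbit (F ≃ₐ[K] F) : F → Set F)).ncard := by
  have hdiff : Function.Surjective fun w : Fin 2 → F => w 0 - w 1 := fun x =>
    ⟨![x, 0], by simp⟩
  have hdiag : Function.Injective fun (x : F) (_ : Fin 2) => x := fun x y h => congrFun h 0
  have h0 : {0} ∈ Set.range (orbit (F ≃ₐ[K] F) : F → Set F) :=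
    ⟨0, by simpa using orbit_algEquiv_algebraMap (A := F) (0 : K)⟩
  have h1 : {1} ∈ Set.range (orbit (F ≃ₐ[K] F) : F → Set F) :=
    ⟨1, by simpa using orbit_algEquiv_algebraMap (A := F) (1 : K)⟩
  have hpair : ({{0}, {1}} : Set (Set F)).ncard = 2 := Set.ncard_pair (by simp)
  have hsub : ({{0}, {1}} : Set (Set F)) ⊆ Set.range (orbit (F ≃ₐ[K] F) : F → Set F) :=
    Set.insert_subset h0 (Set.singleton_subset_iff.2 h1)
  have hle := Set.ncard_le_ncard hsub
  have hpairdiff := Set.ncard_sdiff hsub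
  have hsingle := Set.ncard_sdiff_singleton_of_mem h0
  rw [range_setOf_isASLH_fixing, Set.ncard_union_eq, Set.ncard_image_of_injective _
    hdiff.preimage_injective, Set.ncard_image_of_injective _ hdiag.image_injective]
  · omega
  · rw [Set.disjoint_left]
    rintro _ ⟨_, ⟨⟨x, rfl⟩, hx⟩, rfl⟩ ⟨T, -, hT⟩
    have hmem : ![x, 0] ∈ (fun w : Fin 2 → F => w 0 - w 1) ⁻¹' orbit (F ≃ₐ[K] F) x := by
      simp
    rw [← hT] at hmem
    obtain ⟨y, -, hy⟩ := hmem
    have hx0 : x = 0 := (congrFun hy 0).symm.trans (congrFun hy 1)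
    subst hx0
    exact hx (by simpa using orbit_algEquiv_algebraMap (A := F) (0 : K))

/-- The fixed points of the `β`-th power of the Frobenius of `L / K` form a field extension of
`K` of degree `gcd([L : K], β)`. -/
theorem card_fixedBy_frobenius_pow {K L : Type*} [Field K] [Field L] [Finite L]
    [Fintype K] [Algebra K L] [Algebra.IsAlgebraic K L] (β : ℕ) :
    Nat.card (fixedBy L (FiniteField.frobeniusAlgEquivOfAlgebraic K L ^ β)) =
      Nat.card K ^ Nat.gcd (finrank K L) β := by
  set σ := FiniteField.frobeniusAlgEquivOfAlgebraic K L
  have hfix : fixedBy L (σ ^ β) =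
      (IntermediateField.fixedField (Subgroup.zpowers (σ ^ β)) : Set L) := by
    ext x
    rw [SetLike.mem_coe, IntermediateField.mem_fixedField_iff, mem_fixedBy]
    constructor
    · intro h f hf
      have hle : Subgroup.zpowers (σ ^ β) ≤ stabilizer (L ≃ₐ[K] L) x := by
        rw [Subgroup.zpowers_le]
        exact h
      exact hle hf
    · intro h
      exact h _ (Subgroup.mem_zpowers _)
  have hfin : finrank (IntermediateField.fixedField (Subgroup.zpowers (σ ^ β))) L =
      finrank K L / Nat.gcd (finrank K L) β := by
    rw [IntermediateField.finrank_fixedField_eq_card, Nat.card_zpowers, orderOf_pow,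
      FiniteField.orderOf_frobeniusAlgEquivOfAlgebraic]
  have hpos : 0 < finrank K L := finrank_pos
  have hmul := finrank_mul_finrank K (IntermediateField.fixedField (Subgroup.zpowers (σ ^ β))) L
  rw [hfin] at hmul
  have hdvd := Nat.gcd_dvd_left (finrank K L) β
  have hdeg : finrank K (IntermediateField.fixedField (Subgroup.zpowers (σ ^ β))) =
      Nat.gcd (finrank K L) β := by
    have hq : 0 < finrank K L / Nat.gcd (finrank K L) β :=
      Nat.div_pos (Nat.le_of_dvd hpos hdvd) (Nat.gcd_pos_of_pos_left _ hpos)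
    exact Nat.eq_of_mul_eq_mul_right hq (hmul.trans (Nat.mul_div_cancel' hdvd).symm)
  rw [hfix, ← hdeg]
  exact Module.natCard_eq_pow_finrank

theorem ncard_range_orbit (G : Type*) {X : Type*} [Group G] [MulAction G X] :
    (Set.range (orbit G : X → Set X)).ncard = Nat.card (Quotient (orbitRel G X)) := by
  rw [← Nat.card_coe_set_eq]
  refine (Nat.card_congr (Equiv.ofBijective
    (Quotient.lift (s := orbitRel G X) (fun x => (⟨orbit G x, x, rfl⟩ :
      Set.range (orbit G : X → Set X))) fun a b h => ?_) ⟨?_, ?_⟩)).symm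
  · exact Subtype.ext (orbit_eq_iff.2 h)
  · rintro ⟨a⟩ ⟨b⟩ h
    exact Quotient.sound (orbit_eq_iff.1 (congrArg Subtype.val h))
  · rintro ⟨_, x, rfl⟩
    exact ⟨Quotient.mk _ x, rfl⟩

/-- Burnside's count of the Galois orbits of a finite field over a subfield. -/
theorem finrank_mul_ncard_range_orbit (K L : Type*) [Field K] [Field L] [Finite L]
    [Fintype K] [Algebra K L] [Algebra.IsAlgebraic K L] :
    finrank K L * (Set.range (orbit (L ≃ₐ[K] L) : L → Set L)).ncard =
      ∑ β ∈ Finset.Icc 1 (finrank K L), Nat.card K ^ Nat.gcd (finrank K L) β := by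
  classical
  have := Fintype.ofFinite L
  have := Fintype.ofFinite (L ≃ₐ[K] L)
  have := Fintype.ofFinite (Quotient (orbitRel (L ≃ₐ[K] L) L))
  have hb := sum_card_fixedBy_eq_card_orbits_mul_card_group (L ≃ₐ[K] L) L
  have hcard : Fintype.card (L ≃ₐ[K] L) = finrank K L := by
    rw [← Nat.card_eq_fintype_card, IsGalois.card_aut_eq_finrank]
  rw [hcard, ← Nat.card_eq_fintype_card, mul_comm] at hb
  rw [ncard_range_orbit, ← hb]
  have hIcc : ∑ β ∈ Finset.Icc 1 (finrank K L), Nat.card K ^ Nat.gcd (finrank K L) β =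
      ∑ β ∈ Finset.range (finrank K L), Nat.card K ^ Nat.gcd (finrank K L) β := by
    have hpos : 0 < finrank K L := finrank_pos
    rw [← Finset.Ico_add_one_right_eq_Icc, Finset.sum_Ico_succ_top hpos,
      Finset.range_eq_Ico, Finset.sum_eq_sum_Ico_succ_bot hpos, Nat.gcd_self,
      Nat.gcd_zero_right, add_comm]
  rw [hIcc, Finset.sum_range]
  refine (Fintype.sum_bijective _
    (FiniteField.bijective_frobeniusAlgEquivOfAlgebraic_pow K L) _ _ fun β => ?_).symm
  rw [← card_fixedBy_frobenius_pow, Nat.card_eq_fintype_card]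

/-- With `m = α/ω`, the number `N` of orbits of the stabilizer of `(0⃗,1⃗)` in
`ASL_H(2,n)` on `V \\ {0⃗,1⃗}` satisfies `m·(N+3) = 2·∑_{β=1}^{m} q^{gcd(m,β)}`. -/
theorem card_orbits_of_stabilizer
    {F : Type*} [Field F] [Fintype F]
    (p α ω : ℕ) (hp : p.Prime) (hα : 0 < α) (hω : 0 < ω) (hωα : ω ∣ α)
    (hF : Fintype.card F = p ^ α)
    (K : Subfield F) (hK : Nat.card K = p ^ ω)
    (m : ℕ) (hm : α = ω * m) :
    m * (Set.ncard (Set.range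
        fun v : {v : Fin 2 → F // v ≠ ![0,0] ∧ v ≠ ![1,1]} =>
          {w : Fin 2 → F | ∃ g, IsASLH K g ∧ g ![0,0] = ![0,0] ∧
            g ![1,1] = ![1,1] ∧ w = g v.1}) + 3)
      = 2 * ∑ β ∈ Finset.Icc 1 m, (p ^ ω) ^ Nat.gcd m β := by
  have : Fintype K := Fintype.ofFinite K
  have hrank : finrank K F = m := by
    have h := Module.natCard_eq_pow_finrank (K := K) (V := F)
    rw [Nat.card_eq_fintype_card, hF, hK, hm, pow_mul] at h
    exact (Nat.pow_right_injective
      (show 2 ≤ p ^ ω from hp.two_le.trans (Nat.le_self_pow hω.ne' p)) h).symm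
  rw [ncard_range_setOf_isASLH_fixing, mul_left_comm, ← hrank, finrank_mul_ncard_range_orbit, hK]
end

section
/- For every 𝔞 ∈ F with 𝔞 ≠ 0, and for every pair of distinct vectors x, y ∈ V, the number of z ∈ V with (x,y,z) ∈ ^𝔞R equals n·deg_K(𝔞). (That is, the third valency of the relation ^𝔞R is n·deg_K(𝔞).) -/
open Matrix

/-- `^𝔞R` : the orbit of `(0⃗, 1⃗, (0,𝔞)ᵀ)` under the diagonal action of
`ASL_H(2,n)` on `V × V × V`. -/
def Rsub {F : Type*} [Field F] (K : Subfield F) (a : F) :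
    Set ((Fin 2 → F) × (Fin 2 → F) × (Fin 2 → F)) :=
  { t | ∃ g, IsASLH K g ∧ t = (g ![0,0], g ![1,1], g ![0,a]) }

/-- The conjugates of `a` under `Gal(F/K)` are the roots of its minimal polynomial. -/
lemma exists_inH_eq_iff_mem_rootSet {F : Type*} [Field F] [Finite F] (K : Subfield F) (a r : F) :
    (∃ φ : F ≃+* F, InH K φ ∧ φ a = r) ↔ r ∈ (minpoly K a).rootSet F := by
  rw [← isConjRoot_iff_mem_minpoly_rootSet (Algebra.IsIntegral.isIntegral a),
    IsConjRoot.comm, isConjRoot_iff_exists_algEquiv]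
  constructor
  · rintro ⟨φ, hφ, rfl⟩
    exact ⟨AlgEquiv.ofRingEquiv (f := φ) fun x => hφ x x.2, rfl⟩
  · rintro ⟨σ, rfl⟩
    exact ⟨σ.toRingEquiv, fun x hx => σ.commutes ⟨x, hx⟩, rfl⟩

lemma ncard_rootSet_minpoly {F : Type*} [Field F] [Finite F] (K : Subfield F) (a : F) :
    ((minpoly K a).rootSet F).ncard = (minpoly K a).natDegree := by
  rw [← Nat.card_coe_set_eq, Nat.card_eq_fintype_card]
  exact Polynomial.card_rootSet_eq_natDegree (Algebra.IsSeparable.isSeparable K a)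
    (Normal.splits inferInstance a)

/-- Membership in `^𝔞R` is governed by the determinant of `y - x` and `z - x`. -/
lemma mem_Rsub_iff {F : Type*} [Field F] [Finite F] (K : Subfield F) {a : F} (ha : a ≠ 0)
    (x y z : Fin 2 → F) :
    (x, y, z) ∈ Rsub K a ↔
      (y 0 - x 0) * (z 1 - x 1) - (y 1 - x 1) * (z 0 - x 0) ∈ (minpoly K a).rootSet F := by
  rw [← exists_inH_eq_iff_mem_rootSet]
  constructor
  · rintro ⟨g, ⟨A, b, φ, hA, hφ, hg⟩, h⟩
    simp only [Prod.mk.injEq, hg] at h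
    obtain ⟨rfl, rfl, rfl⟩ := h
    refine ⟨φ, hφ, ?_⟩
    rw [det_fin_two] at hA
    simp
    linear_combination (-φ a) * hA
  · rintro ⟨φ, hφ, h⟩
    have hr : φ a ≠ 0 := by simpa using ha
    refine ⟨fun v => !![y 0 - x 0 - (z 0 - x 0) / φ a, (z 0 - x 0) / φ a;
        y 1 - x 1 - (z 1 - x 1) / φ a, (z 1 - x 1) / φ a].mulVec (fun i => φ (v i)) + x,
      ⟨_, x, φ, ?_, hφ, fun _ => rfl⟩, ?_⟩
    · rw [det_fin_two_of]
      linear_combination (-(φ a)⁻¹) * h + mul_inv_cancel₀ hr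
    · simp only [Prod.mk.injEq]
      refine ⟨?_, ?_, ?_⟩ <;> ext i <;> fin_cases i <;>
        simp [dotProduct, Fin.sum_univ_two, ha]

/-- Preimages under an affine form given by a nonzero vector `d`. -/
lemma ncard_setOf_det_mem {F : Type*} [Field F] [Finite F] (x d : Fin 2 → F) (hd : d ≠ 0)
    (S : Set F) :
    {z : Fin 2 → F | d 0 * (z 1 - x 1) - d 1 * (z 0 - x 0) ∈ S}.ncard = Nat.card F * S.ncard := by
  obtain ⟨c, hc⟩ : ∃ c : Fin 2 → F, d 0 * c 1 - d 1 * c 0 = 1 := by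
    by_cases h0 : d 0 = 0
    · have h1 : d 1 ≠ 0 := fun h1 => hd (by ext i; fin_cases i <;> assumption)
      exact ⟨![-(d 1)⁻¹, 0], by simp [h1]⟩
    · exact ⟨![0, (d 0)⁻¹], by simp [h0]⟩
  rw [← Set.ncard_univ, ← Set.ncard_prod]
  symm
  refine Set.ncard_congr (fun s _ => x + s.1 • d + s.2 • c) ?_ ?_ ?_
  · rintro ⟨t, r⟩ ⟨-, hr⟩
    have : r = d 0 * ((x + t • d + r • c) 1 - x 1) - d 1 * ((x + t • d + r • c) 0 - x 0) := by
      simp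
      linear_combination (-r) * hc
    simpa only [Set.mem_ofPred_eq, ← this] using hr
  · rintro ⟨t, r⟩ ⟨t', r'⟩ - - h
    have e0 := congrFun h 0
    have e1 := congrFun h 1
    simp only [Pi.add_apply, Pi.smul_apply, smul_eq_mul] at e0 e1
    ext
    · linear_combination (t' - t) * hc + c 1 * e0 - c 0 * e1
    · linear_combination (r' - r) * hc + d 0 * e1 - d 1 * e0
  · intro z hz
    refine ⟨(c 1 * (z 0 - x 0) - c 0 * (z 1 - x 1), _), ⟨Set.mem_univ _, hz⟩, ?_⟩
    ext i
    fin_cases i <;> simp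
    · linear_combination (z 0 - x 0) * hc
    · linear_combination (z 1 - x 1) * hc

/-- The third valency of `^𝔞R` is `n·deg_K(𝔞)`. -/
theorem third_valency_Rsub
    {F : Type*} [Field F] [Fintype F]
    (p α ω : ℕ) (hp : p.Prime) (hα : 0 < α) (hω : 0 < ω) (hωα : ω ∣ α)
    (hF : Fintype.card F = p ^ α)
    (K : Subfield F) (hK : Nat.card K = p ^ ω)
    (𝔞 : F) (h𝔞 : 𝔞 ≠ 0)
    (x y : Fin 2 → F) (hxy : x ≠ y) :
    Set.ncard {z : Fin 2 → F | (x, y, z) ∈ Rsub K 𝔞}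
      = p ^ α * (minpoly K 𝔞).natDegree := by
  simp only [mem_Rsub_iff K h𝔞]
  rw [← hF, ← Nat.card_eq_fintype_card, ← ncard_rootSet_minpoly]
  exact ncard_setOf_det_mem x (y - x) (sub_ne_zero.mpr hxy.symm) _
end
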